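/- The adjoint maps ad(y_1), ..., ad(y_m) on SL^{n,m} are linearly independent odd superderivations, and together with ad(x_1),...,ad(x_n), ad(t_1), ad(t_2), ad(t_3) they form a basis of the superderivation algebra Der(SL^{n,m}); i.e., Der(SL^{n,m}) consists entirely of inner superderivations and has dimension (n+3 | m). -/

import Mathlib

namespace SolvableModelFiliform

/-- Index type of `SL^{n,m}`: `x`-indices, then `t`-indices, then `y`-indices (0-based). -/
abbrev Idx (n m : ℕ) := Fin n ⊕ (Fin 3 ⊕ Fin m)

/-- Underlying vector space over ℂ. -/
abbrev V (n m : ℕ) := Idx n m →₀ ℂ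

/-- `X n m k` is the basis vector `x_k` (1-based), or `0` if out of range. -/
noncomputable def X (n m k : ℕ) : V n m :=
  if h : 1 ≤ k ∧ k ≤ n then Finsupp.single (Sum.inl ⟨k - 1, by omega⟩) 1 else 0

/-- `T n m s` is the basis vector `t_s` (`s ∈ {1,2,3}`), or `0` if out of range. -/
noncomputable def T (n m s : ℕ) : V n m :=
  if h : 1 ≤ s ∧ s ≤ 3 then Finsupp.single (Sum.inr (Sum.inl ⟨s - 1, by omega⟩)) 1 else 0

/-- `Y n m k` is the basis vector `y_k` (1-based), or `0` if out of range. -/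
noncomputable def Y (n m k : ℕ) : V n m :=
  if h : 1 ≤ k ∧ k ≤ m then Finsupp.single (Sum.inr (Sum.inr ⟨k - 1, by omega⟩)) 1 else 0

/-- Structure constants of `SL^{n,m}`:
`[x_1,x_i] = x_{i+1}` (2 ≤ i ≤ n-1), `[x_1,y_j] = y_{j+1}` (1 ≤ j ≤ m-1),
`[t_1,x_i] = i x_i`, `[t_1,y_j] = j y_j`, `[t_2,x_i] = x_i` (2 ≤ i ≤ n),
`[t_3,y_j] = y_j`, extended skew-symmetrically. -/
noncomputable def c (n m : ℕ) : Idx n m → Idx n m → V n m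
  | Sum.inl i, Sum.inl j =>
      if i.val = 0 ∧ 1 ≤ j.val then X n m (j.val + 2)
      else if j.val = 0 ∧ 1 ≤ i.val then -X n m (i.val + 2) else 0
  | Sum.inl i, Sum.inr (Sum.inr j) => if i.val = 0 then Y n m (j.val + 2) else 0
  | Sum.inr (Sum.inr j), Sum.inl i => if i.val = 0 then -Y n m (j.val + 2) else 0
  | Sum.inr (Sum.inl s), Sum.inl i =>
      if s.val = 0 then ((i.val + 1 : ℕ) : ℂ) • X n m (i.val + 1)
      else if s.val = 1 ∧ 1 ≤ i.val then X n m (i.val + 1) else 0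
  | Sum.inl i, Sum.inr (Sum.inl s) =>
      -(if s.val = 0 then ((i.val + 1 : ℕ) : ℂ) • X n m (i.val + 1)
        else if s.val = 1 ∧ 1 ≤ i.val then X n m (i.val + 1) else 0)
  | Sum.inr (Sum.inl s), Sum.inr (Sum.inr j) =>
      if s.val = 0 then ((j.val + 1 : ℕ) : ℂ) • Y n m (j.val + 1)
      else if s.val = 2 then Y n m (j.val + 1) else 0
  | Sum.inr (Sum.inr j), Sum.inr (Sum.inl s) =>
      -(if s.val = 0 then ((j.val + 1 : ℕ) : ℂ) • Y n m (j.val + 1)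
        else if s.val = 2 then Y n m (j.val + 1) else 0)
  | Sum.inr (Sum.inl _), Sum.inr (Sum.inl _) => 0
  | Sum.inr (Sum.inr _), Sum.inr (Sum.inr _) => 0

/-- The bracket of `SL^{n,m}`, as a bilinear map. -/
noncomputable def brL (n m : ℕ) : V n m →ₗ[ℂ] V n m →ₗ[ℂ] V n m :=
  Finsupp.lsum ℂ (fun a =>
    LinearMap.toSpanSingleton ℂ (V n m →ₗ[ℂ] V n m)
      (Finsupp.lsum ℂ (fun b => LinearMap.toSpanSingleton ℂ (V n m) (c n m a b))))

/-- The bracket. -/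
noncomputable def br (n m : ℕ) (u v : V n m) : V n m := brL n m u v

/-- Parity of the basis indices (`x`'s and `t`'s even, `y`'s odd). -/
def par (n m : ℕ) : Idx n m → ZMod 2 :=
  Sum.elim (fun _ => 0) (Sum.elim (fun _ => 0) (fun _ => 1))

/-- `u` is homogeneous of degree `s`. -/
def IsHomog (n m : ℕ) (u : V n m) (s : ZMod 2) : Prop :=
  ∀ a ∈ u.support, par n m a = s

/-- An even superderivation: parity-preserving and `D[u,v] = [Du,v] + [u,Dv]`. -/
def IsEvenDer (n m : ℕ) (D : Module.End ℂ (V n m)) : Prop :=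
  (∀ (u : V n m) (s : ZMod 2), IsHomog n m u s → IsHomog n m (D u) s) ∧
  (∀ u v : V n m, D (br n m u v) = br n m (D u) v + br n m u (D v))

/-- An odd superderivation: parity-reversing and
`D[u,v] = [Du,v] + (-1)^{|u|}[u,Dv]` for homogeneous `u`. -/
def IsOddDer (n m : ℕ) (D : Module.End ℂ (V n m)) : Prop :=
  (∀ (u : V n m) (s : ZMod 2), IsHomog n m u s → IsHomog n m (D u) (s + 1)) ∧
  (∀ (u v : V n m) (su : ZMod 2), IsHomog n m u su →
    D (br n m u v) = br n m (D u) v + ((-1 : ℂ) ^ su.val) • br n m u (D v))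

/-- The adjoint operator `ad(z) = [z,·]` associated with a basis index. -/
noncomputable def adF (n m : ℕ) (a : Idx n m) : Module.End ℂ (V n m) :=
  brL n m (Finsupp.single a 1)

/-- Eigenvalue of the toral part of `u` on the basis vector of index `a`. -/
noncomputable def lam (n m : ℕ) (u : V n m) : Idx n m → ℂ
  | Sum.inl i => ((i.val : ℂ) + 1) * u (Sum.inr (Sum.inl 0)) +
      (if i.val = 0 then 0 else u (Sum.inr (Sum.inl 1)))
  | Sum.inr (Sum.inl _) => 0
  | Sum.inr (Sum.inr j) => ((j.val : ℂ) + 1) * u (Sum.inr (Sum.inl 0)) +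
      u (Sum.inr (Sum.inl 2))

/-- Shift part of the bracket. -/
noncomputable def shf (n m : ℕ) (hn : 0 < n) (u v : V n m) : Idx n m → ℂ
  | Sum.inl i => if 2 ≤ i.val then
      u (Sum.inl ⟨0, hn⟩) * v (Sum.inl ⟨i.val - 1, by omega⟩)
      - v (Sum.inl ⟨0, hn⟩) * u (Sum.inl ⟨i.val - 1, by omega⟩) else 0
  | Sum.inr (Sum.inl _) => 0
  | Sum.inr (Sum.inr j) => if 1 ≤ j.val then
      u (Sum.inl ⟨0, hn⟩) * v (Sum.inr (Sum.inr ⟨j.val - 1, by omega⟩))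
      - v (Sum.inl ⟨0, hn⟩) * u (Sum.inr (Sum.inr ⟨j.val - 1, by omega⟩)) else 0

lemma brL_single (n m : ℕ) (a b : Idx n m) (r s : ℂ) :
    brL n m (Finsupp.single a r) (Finsupp.single b s) = r • s • c n m a b := by
  simp [brL]

lemma lam_add (n m : ℕ) (u v : V n m) (a : Idx n m) :
    lam n m (u + v) a = lam n m u a + lam n m v a := by
  rcases a with i | s | j <;> simp only [lam, Finsupp.add_apply] <;> (try split_ifs) <;> ring

lemma shf_add_left (n m : ℕ) (hn : 0 < n) (u v w : V n m) (a : Idx n m) :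
    shf n m hn (u + v) w a = shf n m hn u w a + shf n m hn v w a := by
  rcases a with i | s | j <;> simp only [shf, Finsupp.add_apply] <;> (try split_ifs) <;> ring

lemma shf_add_right (n m : ℕ) (hn : 0 < n) (u v w : V n m) (a : Idx n m) :
    shf n m hn w (u + v) a = shf n m hn w u a + shf n m hn w v a := by
  rcases a with i | s | j <;> simp only [shf, Finsupp.add_apply] <;> (try split_ifs) <;> ring

lemma lam_smul (n m : ℕ) (r : ℂ) (v : V n m) (a : Idx n m) :
    lam n m (r • v) a = r * lam n m v a := by
  rcases a with i | s | j <;> simp only [lam, Finsupp.smul_apply, smul_eq_mul] <;>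
    (try split_ifs) <;> ring

lemma shf_smul_left (n m : ℕ) (hn : 0 < n) (r : ℂ) (v w : V n m) (a : Idx n m) :
    shf n m hn (r • v) w a = r * shf n m hn v w a := by
  rcases a with i | s | j <;> simp only [shf, Finsupp.smul_apply, smul_eq_mul] <;>
    (try split_ifs) <;> ring

lemma shf_smul_right (n m : ℕ) (hn : 0 < n) (r : ℂ) (v w : V n m) (a : Idx n m) :
    shf n m hn w (r • v) a = r * shf n m hn w v a := by
  rcases a with i | s | j <;> simp only [shf, Finsupp.smul_apply, smul_eq_mul] <;>
    (try split_ifs) <;> ring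

lemma c_apply (n m : ℕ) (hn : 0 < n) (a b d : Idx n m) :
    c n m a b d = lam n m (Finsupp.single a 1) d * (Finsupp.single b 1 : V n m) d
      - lam n m (Finsupp.single b 1) d * (Finsupp.single a 1 : V n m) d
      + shf n m hn (Finsupp.single a 1) (Finsupp.single b 1) d := by
  rcases a with ⟨i, hi⟩ | s | ⟨i, hi⟩ <;> rcases b with ⟨j, hj⟩ | t | ⟨j, hj⟩ <;>
    rcases d with ⟨k, hk⟩ | q | ⟨k, hk⟩ <;>
    (try fin_cases s) <;> (try fin_cases t) <;>
    simp [c, lam, shf, X, Y, Finsupp.single_apply] <;>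
    (try split_ifs) <;> (try simp [Finsupp.single_apply]) <;> (try grind)

lemma br_apply (n m : ℕ) (hn : 0 < n) (u v : V n m) (d : Idx n m) :
    brL n m u v d = lam n m u d * v d - lam n m v d * u d + shf n m hn u v d := by
  induction u using Finsupp.induction_linear with
  | zero => rcases d with i | s | j <;> simp [lam, shf]
  | add f g hf hg =>
    simp only [map_add, LinearMap.add_apply, Finsupp.add_apply, lam_add, shf_add_left, hf, hg]
    ring
  | single a r =>
    induction v using Finsupp.induction_linear with
    | zero => rcases d with i | s | j <;> simp [lam, shf]
    | add f g hf hg =>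
      simp only [map_add, Finsupp.add_apply, lam_add, shf_add_right, hf, hg]
      ring
    | single b s =>
      have h1 : (Finsupp.single a r : V n m) = r • Finsupp.single a 1 := by simp
      have h2 : (Finsupp.single b s : V n m) = s • Finsupp.single b 1 := by simp
      rw [brL_single, Finsupp.smul_apply, Finsupp.smul_apply, c_apply n m hn, h1, h2]
      simp only [lam_smul, shf_smul_left, shf_smul_right, Finsupp.smul_apply, smul_eq_mul]
      ring

lemma jacobi (n m : ℕ) (hn : 0 < n) (u v w : V n m) :
    brL n m u (brL n m v w) = brL n m (brL n m u v) w + brL n m v (brL n m u w) := by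
  ext d
  rcases d with ⟨k, hk⟩ | q | ⟨k, hk⟩
  · rcases k with _ | _ | _ | k <;>
      simp [br_apply n m hn, lam, shf] <;> ring
  · simp [br_apply n m hn, lam, shf]
  · rcases k with _ | _ | k <;>
      simp [br_apply n m hn, lam, shf] <;> ring

/-- Leibniz rule on the toral elements and on `x_1`. -/
def Leib (n m : ℕ) (hn : 0 < n) (D : Module.End ℂ (V n m)) : Prop :=
  (∀ (s : Fin 3) (v : V n m), D (brL n m (Finsupp.single (Sum.inr (Sum.inl s)) 1) v) =
    brL n m (D (Finsupp.single (Sum.inr (Sum.inl s)) 1)) v +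
    brL n m (Finsupp.single (Sum.inr (Sum.inl s)) 1) (D v)) ∧
  (∀ (v : V n m), D (brL n m (Finsupp.single (Sum.inl ⟨0, hn⟩) 1) v) =
    brL n m (D (Finsupp.single (Sum.inl ⟨0, hn⟩) 1)) v +
    brL n m (Finsupp.single (Sum.inl ⟨0, hn⟩) 1) (D v))

lemma br_toral (n m : ℕ) (hn : 0 < n) (u v : V n m) (hx : ∀ i, u (Sum.inl i) = 0)
    (hy : ∀ j, u (Sum.inr (Sum.inr j)) = 0) (a : Idx n m) :
    brL n m u v a = lam n m u a * v a := by
  rw [br_apply n m hn]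
  rcases a with i | s | j <;> simp [hx, hy, lam, shf]

lemma br_toral_single (n m : ℕ) (hn : 0 < n) (u : V n m) (hx : ∀ i, u (Sum.inl i) = 0)
    (hy : ∀ j, u (Sum.inr (Sum.inr j)) = 0) (b : Idx n m) :
    brL n m u (Finsupp.single b 1) = lam n m u b • Finsupp.single b 1 := by
  ext a
  rw [br_toral n m hn u _ hx hy]
  by_cases h : b = a
  · subst h; simp
  · simp [h]

lemma rigid (n m : ℕ) (hn : 3 ≤ n) (hm : 2 ≤ m) (D : Module.End ℂ (V n m))
    (hD : Leib n m (by omega) D)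
    (hx : ∀ i, D (Finsupp.single (Sum.inr (Sum.inl 0)) 1) (Sum.inl i) = 0)
    (hy : ∀ j, D (Finsupp.single (Sum.inr (Sum.inl 0)) 1) (Sum.inr (Sum.inr j)) = 0)
    (h1 : D (Finsupp.single (Sum.inl ⟨0, by omega⟩) 1) (Sum.inl ⟨0, by omega⟩) = 0)
    (h2 : D (Finsupp.single (Sum.inl ⟨1, by omega⟩) 1) (Sum.inl ⟨1, by omega⟩) = 0)
    (h3 : D (Finsupp.single (Sum.inr (Sum.inr ⟨0, by omega⟩)) 1)
      (Sum.inr (Sum.inr ⟨0, by omega⟩)) = 0) : D = 0 := by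
  have hn0 : 0 < n := by omega
  obtain ⟨hT, hX⟩ := hD
  have tx : ∀ (s : Fin 3) (i : Fin n),
      (Finsupp.single (Sum.inr (Sum.inl s)) 1 : V n m) (Sum.inl i) = 0 := by
    intro s i; simp
  have ty : ∀ (s : Fin 3) (j : Fin m),
      (Finsupp.single (Sum.inr (Sum.inl s)) 1 : V n m) (Sum.inr (Sum.inr j)) = 0 := by
    intro s j; simp
  -- step 1: `D t_s` is toral
  have key : ∀ (s : Fin 3) (a : Idx n m),
      lam n m (Finsupp.single (Sum.inr (Sum.inl 0)) 1) a *
        D (Finsupp.single (Sum.inr (Sum.inl s)) 1) a = 0 := by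
    intro s a
    have h := hT 0 (Finsupp.single (Sum.inr (Sum.inl s)) 1)
    have h' := DFunLike.congr_fun h a
    rw [br_toral_single n m hn0 _ (tx 0) (ty 0), Finsupp.add_apply,
      br_toral n m hn0 _ _ hx hy, br_toral n m hn0 _ _ (tx 0) (ty 0)] at h'
    rcases a with i | q | j
    · simpa [lam] using h'
    · simp [lam]
    · simpa [lam] using h'
  have hxs : ∀ s i, D (Finsupp.single (Sum.inr (Sum.inl s)) 1) (Sum.inl i) = 0 := by
    intro s i
    have h := key s (Sum.inl i)
    simp [lam] at h
    exact h.resolve_left (Nat.cast_add_one_ne_zero _)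
  have hys : ∀ s j, D (Finsupp.single (Sum.inr (Sum.inl s)) 1) (Sum.inr (Sum.inr j)) = 0 := by
    intro s j
    have h := key s (Sum.inr (Sum.inr j))
    simp [lam] at h
    exact h.resolve_left (Nat.cast_add_one_ne_zero _)
  have key2 : ∀ (s : Fin 3) (a b : Idx n m),
      lam n m (Finsupp.single (Sum.inr (Sum.inl s)) 1) b * D (Finsupp.single b 1) a =
      lam n m (D (Finsupp.single (Sum.inr (Sum.inl s)) 1)) a * (Finsupp.single b 1 : V n m) a +
      lam n m (Finsupp.single (Sum.inr (Sum.inl s)) 1) a * D (Finsupp.single b 1) a := by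
    intro s a b
    have h' := DFunLike.congr_fun (hT s (Finsupp.single b 1)) a
    rw [br_toral_single n m hn0 _ (tx s) (ty s), Finsupp.add_apply,
      br_toral n m hn0 _ _ (hxs s) (hys s), br_toral n m hn0 _ _ (tx s) (ty s), map_smul] at h'
    simpa using h'
  have key3 : ∀ (s : Fin 3) (b : Idx n m),
      lam n m (D (Finsupp.single (Sum.inr (Sum.inl s)) 1)) b = 0 := by
    intro s b
    have h := key2 s b b
    simpa using h
  -- `D t_s = 0`
  have ht : ∀ s, D (Finsupp.single (Sum.inr (Sum.inl s)) 1) = 0 := by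
    intro s
    have e1 := key3 s (Sum.inl ⟨0, by omega⟩)
    have e2 := key3 s (Sum.inl ⟨1, by omega⟩)
    have e3 := key3 s (Sum.inr (Sum.inr ⟨0, by omega⟩))
    simp [lam] at e1 e2 e3
    simp [e1] at e2 e3
    ext a
    rcases a with i | q | j
    · simpa using hxs s i
    · fin_cases q
      · simpa using e1
      · simpa using e2
      · simpa using e3
    · simpa using hys s j
  have key4 : ∀ (s : Fin 3) (a b : Idx n m),
      lam n m (Finsupp.single (Sum.inr (Sum.inl s)) 1) b * D (Finsupp.single b 1) a =
      lam n m (Finsupp.single (Sum.inr (Sum.inl s)) 1) a * D (Finsupp.single b 1) a := by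
    intro s a b
    rw [key2, key3]; ring
  have off : ∀ a b : Idx n m, a ≠ b → D (Finsupp.single b 1) a = 0 := by
    intro a b hab
    have k0 := key4 0 a b
    have k2 := key4 2 a b
    rcases b with ⟨i, hi⟩ | s | ⟨i, hi⟩
    · rcases a with ⟨j, hj⟩ | q | ⟨j, hj⟩
      · simp [lam] at k0
        have : j ≠ i := by simpa using hab
        exact k0.resolve_left (fun h => this h.symm)
      · simp [lam] at k0
        exact k0.resolve_left (Nat.cast_add_one_ne_zero _)
      · simp [lam] at k2
        exact k2.symm
    · rw [ht]; simp
    · rcases a with ⟨j, hj⟩ | q | ⟨j, hj⟩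
      · simp [lam] at k2
        exact k2
      · simp [lam] at k0
        exact k0.resolve_left (Nat.cast_add_one_ne_zero _)
      · simp [lam] at k0
        have : j ≠ i := by simpa using hab
        exact k0.resolve_left (fun h => this h.symm)
  have hx0 : D (Finsupp.single (Sum.inl ⟨0, hn0⟩) 1) = 0 := by
    ext a
    by_cases h : a = Sum.inl ⟨0, hn0⟩
    · subst h; simpa using h1
    · simpa using off _ _ h
  have bx : ∀ i (hi : i + 2 < n), brL n m (Finsupp.single (Sum.inl ⟨0, hn0⟩) 1)
      (Finsupp.single (Sum.inl ⟨i + 1, by omega⟩) 1) =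
      Finsupp.single (Sum.inl ⟨i + 2, hi⟩) 1 := by
    intro i hi
    rw [brL_single]
    have : i + 3 ≤ n := hi
    simp [c, X, this]
  have hby : ∀ i (hi : i + 1 < m), brL n m (Finsupp.single (Sum.inl ⟨0, hn0⟩) 1)
      (Finsupp.single (Sum.inr (Sum.inr ⟨i, by omega⟩)) 1) =
      Finsupp.single (Sum.inr (Sum.inr ⟨i + 1, hi⟩)) 1 := by
    intro i hi
    rw [brL_single]
    have : i + 2 ≤ m := hi
    simp [c, Y, this]
  have dx : ∀ i (hi : i + 1 < n), D (Finsupp.single (Sum.inl ⟨i + 1, hi⟩) 1) = 0 := by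
    intro i
    induction i with
    | zero =>
      intro hi
      ext a
      by_cases h : a = Sum.inl ⟨1, hi⟩
      · subst h; simpa using h2
      · simpa using off _ _ h
    | succ i ih =>
      intro hi
      have h := hX (Finsupp.single (Sum.inl ⟨i + 1, by omega⟩) 1)
      rw [bx i hi, hx0, ih] at h
      simpa using h
  have dy : ∀ i (hi : i < m), D (Finsupp.single (Sum.inr (Sum.inr ⟨i, hi⟩)) 1) = 0 := by
    intro i
    induction i with
    | zero =>
      intro hi
      ext a
      by_cases h : a = Sum.inr (Sum.inr ⟨0, hi⟩)
      · subst h; simpa using h3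
      · simpa using off _ _ h
    | succ i ih =>
      intro hi
      have h := hX (Finsupp.single (Sum.inr (Sum.inr ⟨i, by omega⟩)) 1)
      rw [hby i hi, hx0, ih] at h
      simpa using h
  apply Finsupp.lhom_ext'
  intro b
  apply LinearMap.ext_ring
  rcases b with ⟨i, hi⟩ | s | ⟨i, hi⟩
  · rcases i with _ | i
    · simpa using hx0
    · simpa using dx i hi
  · simpa using ht s
  · simpa using dy i hi

lemma leib_inner (n m : ℕ) (hn : 3 ≤ n) (hm : 2 ≤ m) (D : Module.End ℂ (V n m))
    (hD : Leib n m (by omega) D) : ∃ z, D = brL n m z := by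
  have hn0 : 0 < n := by omega
  let α : ℂ := D (Finsupp.single (Sum.inl ⟨0, by omega⟩) 1) (Sum.inl ⟨0, by omega⟩)
  let β : ℂ := D (Finsupp.single (Sum.inl ⟨1, by omega⟩) 1) (Sum.inl ⟨1, by omega⟩) - 2 * α
  let γ : ℂ := D (Finsupp.single (Sum.inr (Sum.inr ⟨0, by omega⟩)) 1)
      (Sum.inr (Sum.inr ⟨0, by omega⟩)) - α
  let dt := D (Finsupp.single (Sum.inr (Sum.inl 0)) 1)
  let z : V n m := Finsupp.equivFunOnFinite.symm (Sum.elim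
    (fun i => - dt (Sum.inl i) / ((i.val : ℂ) + 1)) (Sum.elim ![α, β, γ]
    (fun j => - dt (Sum.inr (Sum.inr j)) / ((j.val : ℂ) + 1))))
  have zx : ∀ i, z (Sum.inl i) = - dt (Sum.inl i) / ((i.val : ℂ) + 1) := fun _ => rfl
  have zy : ∀ j, z (Sum.inr (Sum.inr j)) = - dt (Sum.inr (Sum.inr j)) / ((j.val : ℂ) + 1) :=
    fun _ => rfl
  have z0 : z (Sum.inr (Sum.inl 0)) = α := rfl
  have z1 : z (Sum.inr (Sum.inl 1)) = β := rfl
  have z2 : z (Sum.inr (Sum.inl 2)) = γ := rfl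
  refine ⟨z, sub_eq_zero.mp (rigid n m hn hm _ ?_ ?_ ?_ ?_ ?_ ?_)⟩
  · obtain ⟨hT, hX⟩ := hD
    constructor
    · intro s v
      simp only [LinearMap.sub_apply, map_sub, hT, jacobi n m hn0 z]
      abel
    · intro v
      simp only [LinearMap.sub_apply, map_sub, hX, jacobi n m hn0 z]
      abel
  · intro i
    have : (i.val : ℂ) + 1 ≠ 0 := Nat.cast_add_one_ne_zero _
    simp [br_apply n m hn0, lam, shf, zx, dt]
    field_simp
    ring
  · intro i
    have : (i.val : ℂ) + 1 ≠ 0 := Nat.cast_add_one_ne_zero _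
    simp [br_apply n m hn0, lam, shf, zy, dt]
    field_simp
    ring
  · simp [br_apply n m hn0, lam, shf, z0, α]
  · simp [br_apply n m hn0, lam, shf, z0, z1, β]
    ring
  · simp [br_apply n m hn0, lam, shf, z0, z2, γ]

lemma linComb (n m : ℕ) (l : V n m) :
    Finsupp.linearCombination ℂ (adF n m) l = brL n m l := by
  induction l using Finsupp.induction_linear with
  | zero => simp
  | add f g hf hg => simp [hf, hg]
  | single a r =>
    rw [Finsupp.linearCombination_single, adF, ← map_smul]
    simp

lemma center (n m : ℕ) (hn : 3 ≤ n) (hm : 2 ≤ m) (l : V n m) (h : brL n m l = 0) : l = 0 := by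
  have hn0 : 0 < n := by omega
  have e : ∀ v a, brL n m l v a = 0 := by intro v a; rw [h]; simp
  have e1 := e (Finsupp.single (Sum.inl ⟨0, by omega⟩) 1) (Sum.inl ⟨0, by omega⟩)
  have e2 := e (Finsupp.single (Sum.inl ⟨1, by omega⟩) 1) (Sum.inl ⟨1, by omega⟩)
  have e3 := e (Finsupp.single (Sum.inr (Sum.inr ⟨0, by omega⟩)) 1)
      (Sum.inr (Sum.inr ⟨0, by omega⟩))
  simp [br_apply n m hn0, lam, shf] at e1 e2 e3
  simp [e1] at e2 e3
  ext a
  have e4 := e (Finsupp.single (Sum.inr (Sum.inl 0)) 1) a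
  rcases a with i | q | j
  · simp [br_apply n m hn0, lam, shf] at e4
    simpa using e4.resolve_left (Nat.cast_add_one_ne_zero _)
  · fin_cases q
    · simpa using e1
    · simpa using e2
    · simpa using e3
  · simp [br_apply n m hn0, lam, shf] at e4
    simpa using e4.resolve_left (Nat.cast_add_one_ne_zero _)

lemma homog_iff (n m : ℕ) (u : V n m) (s : ZMod 2) :
    IsHomog n m u s ↔ ∀ a, par n m a ≠ s → u a = 0 := by
  unfold IsHomog
  refine forall_congr' fun a => ?_
  rw [Finsupp.mem_support_iff]
  tauto

lemma homog_even (n m : ℕ) (u : V n m) :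
    IsHomog n m u 0 ↔ ∀ j, u (Sum.inr (Sum.inr j)) = 0 := by
  simp [homog_iff, par]

lemma homog_odd (n m : ℕ) (u : V n m) :
    IsHomog n m u 1 ↔ (∀ i, u (Sum.inl i) = 0) ∧ ∀ s, u (Sum.inr (Sum.inl s)) = 0 := by
  simp [homog_iff, par]

lemma zmod2_cases (s : ZMod 2) : s = 0 ∨ s = 1 := by
  revert s; decide

lemma even_ad (n m : ℕ) (hn : 0 < n) (z : V n m) (hz : IsHomog n m z 0) :
    IsEvenDer n m (brL n m z) := by
  refine ⟨fun u s hu => ?_, fun u v => jacobi n m hn z u v⟩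
  rw [homog_even] at hz
  obtain rfl | rfl := zmod2_cases s
  · rw [homog_even] at *
    intro j
    simp [br_apply n m hn, lam, shf, hz, hu]
  · rw [homog_odd] at *
    simp [br_apply n m hn, lam, shf, hu]

lemma odd_ad (n m : ℕ) (hn : 0 < n) (z : V n m) (hz : IsHomog n m z 1) :
    IsOddDer n m (brL n m z) := by
  have hz' := hz
  rw [homog_odd] at hz'
  refine ⟨fun u s hu => ?_, fun u v s hu => ?_⟩
  · obtain rfl | rfl := zmod2_cases s
    · rw [zero_add, homog_odd]
      rw [homog_even] at hu
      simp [br_apply n m hn, lam, shf, hz']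
    · have : (1 + 1 : ZMod 2) = 0 := by decide
      rw [this, homog_even]
      rw [homog_odd] at hu
      simp [br_apply n m hn, lam, shf, hz', hu]
  · have hj := jacobi n m hn z u v
    obtain rfl | rfl := zmod2_cases s
    · simpa [br] using hj
    · rw [homog_odd] at hu
      have h0 : brL n m u (brL n m z v) = 0 := by
        ext a
        rcases a with i | q | j <;>
          simp [br_apply n m hn, lam, shf, hz', hu]
      rw [h0] at hj
      simp [br, hj, h0]

/-- The adjoint maps `ad(x_1),…,ad(x_n), ad(t_1),ad(t_2),ad(t_3), ad(y_1),…,ad(y_m)` are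
linearly independent superderivations (even for `x`'s and `t`'s, odd for `y`'s) and span
all superderivations of `SL^{n,m}`: every superderivation is inner and
`dim Der(SL^{n,m}) = (n+3 | m)`. -/
theorem superderivations_SL_inner (n m : ℕ) (hn : 3 ≤ n) (hm : 2 ≤ m) :
    LinearIndependent ℂ (adF n m) ∧
    (∀ i : Fin n, IsEvenDer n m (adF n m (Sum.inl i))) ∧
    (∀ s : Fin 3, IsEvenDer n m (adF n m (Sum.inr (Sum.inl s)))) ∧
    (∀ j : Fin m, IsOddDer n m (adF n m (Sum.inr (Sum.inr j)))) ∧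
    (∀ D : Module.End ℂ (V n m), IsEvenDer n m D ∨ IsOddDer n m D →
      D ∈ Submodule.span ℂ (Set.range (adF n m))) := by
  have hn0 : 0 < n := by omega
  refine ⟨?_, fun i => ?_, fun s => ?_, fun j => ?_, fun D hD => ?_⟩
  · intro l l' h
    rw [linComb, linComb] at h
    refine sub_eq_zero.mp (center n m hn hm (l - l') ?_)
    rw [map_sub, h, sub_self]
  · exact even_ad n m hn0 _ ((homog_even n m _).2 (by simp))
  · exact even_ad n m hn0 _ ((homog_even n m _).2 (by simp))
  · exact odd_ad n m hn0 _ ((homog_odd n m _).2 (by simp))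
  · have hL : Leib n m hn0 D := by
      rcases hD with hD | hD
      · exact ⟨fun s v => hD.2 _ v, fun v => hD.2 _ v⟩
      · constructor
        · intro s v
          have h := hD.2 (Finsupp.single (Sum.inr (Sum.inl s)) 1) v 0
            ((homog_even n m _).2 (by simp))
          simpa [br] using h
        · intro v
          have h := hD.2 (Finsupp.single (Sum.inl ⟨0, hn0⟩) 1) v 0
            ((homog_even n m _).2 (by simp))
          simpa [br] using h
    obtain ⟨z, rfl⟩ := leib_inner n m hn hm D hL
    rw [← Finsupp.range_linearCombination]
    exact ⟨z, linComb n m z⟩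

end SolvableModelFiliform
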